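/- arXiv:1810.04999 — 2 statements merged into one kernel-verified Lean document; each statement's English description precedes it below -/
import Mathlib

section
/- Let S be a commutative ring, let f_1,…,f_c ∈ S be a regular sequence generating the ideal I, let R = S/I, and let K be the Koszul complex of f_1,…,f_c. Let (G_p)_{p≥0} be free S-modules with S-linear maps t_1' : G_p → G_{p−1} such that t_1'∘t_1'(G_p) ⊆ I·G_{p−2}, let M be an R-module, and suppose that the induced complex R⊗_S G of free R-modules (with differentials induced by t_1') is a free resolution of M over R, i.e. coker(R⊗G_1 → R⊗G_0) ≅ M and H_n(R⊗G) = 0 for all n ≥ 1. Let {t_i^{p,q}} be any system of higher CI operators on G. Then the total complex GK, with GK_m = ⊕_{p+q=m} G_p ⊗_S K_q and differential T_m whose component from G_p⊗K_q to G_{p−i}⊗K_{q+i−1} is t_i^{p,q}, is a free resolution of M over S: each GK_m is a free S-module, coker(T_1 : GK_1 → GK_0) ≅ M, and H_m(GK) = 0 for all m ≥ 1. -/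
open scoped TensorProduct
open DirectSum

noncomputable section

namespace TorExtCI

variable (S : Type*) [CommRing S] (c : ℕ)

/-- The `q`-th term `K_q = ⋀^q (S^c)` of the Koszul complex, as a submodule of the exterior
algebra of `S^c`. -/
abbrev KoszulTerm (q : ℕ) : Submodule S (ExteriorAlgebra S (Fin c → S)) :=
  ⋀[S]^q (Fin c → S)

/-- The `S`-linear form on `S^c` sending the `i`-th standard basis vector `e_i` to `f i`. -/
def koszulForm (f : Fin c → S) : Module.Dual S (Fin c → S) :=
  ∑ i, f i • LinearMap.proj i

theorem contractLeft_mem (f : Fin c → S) (q : ℕ) :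
    ∀ x ∈ KoszulTerm S c q,
      CliffordAlgebra.contractLeft (Q := (0 : QuadraticForm S (Fin c → S)))
        (koszulForm S c f) x ∈ KoszulTerm S c (q - 1) := by
  set d := koszulForm S c f with hd
  set p : Submodule S (ExteriorAlgebra S (Fin c → S)) :=
    LinearMap.range (ExteriorAlgebra.ι S (M := Fin c → S)) with hp
  have haux : ∀ x, x ∈ (p ^ 0 : Submodule S _) →
      CliffordAlgebra.contractLeft (Q := (0 : QuadraticForm S (Fin c → S))) d x = 0 := by
    intro x hx
    rw [pow_zero] at hx
    obtain ⟨r, rfl⟩ := Submodule.mem_one.mp hx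
    exact CliffordAlgebra.contractLeft_algebraMap _ _ _
  induction q with
  | zero =>
    intro x hx
    rw [haux x hx]
    exact zero_mem _
  | succ n ih =>
    intro x hx
    match n, ih with
    | 0, _ =>
      have hx' : x ∈ p := by rwa [← pow_one p]
      obtain ⟨v, rfl⟩ := hx'
      have : CliffordAlgebra.contractLeft (Q := (0 : QuadraticForm S (Fin c → S))) d
          (ExteriorAlgebra.ι S v) = algebraMap S _ (d v) :=
        CliffordAlgebra.contractLeft_ι _ _ _
      rw [this]
      exact Submodule.mem_one.mpr ⟨d v, rfl⟩
    | (m + 1), ih =>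
      have hx' : x ∈ p * p ^ (m + 1) := by rwa [← pow_succ'] 
      refine Submodule.mul_induction_on hx' ?_ ?_
      · rintro a ⟨v, rfl⟩ y hy
        rw [CliffordAlgebra.contractLeft_ι_mul]
        refine sub_mem ?_ ?_
        · exact Submodule.smul_mem _ _ hy
        · have h1 : CliffordAlgebra.contractLeft
              (Q := (0 : QuadraticForm S (Fin c → S))) d y ∈ p ^ m := ih y hy
          have : ExteriorAlgebra.ι S v * CliffordAlgebra.contractLeft
              (Q := (0 : QuadraticForm S (Fin c → S))) d y ∈ p * p ^ m :=
            Submodule.mul_mem_mul ⟨v, rfl⟩ h1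
          rwa [← pow_succ'] at this
      · intro y z hy hz
        rw [map_add]
        exact add_mem hy hz

/-- The Koszul differential `∂_q : K_q → K_{q−1}`, given by contraction against `koszulForm f`
(for `q = 0` this is the zero map `K_0 → K_0`). -/
def koszulD (f : Fin c → S) (q : ℕ) :
    KoszulTerm S c q →ₗ[S] KoszulTerm S c (q - 1) :=
  (CliffordAlgebra.contractLeft (Q := (0 : QuadraticForm S (Fin c → S)))
    (koszulForm S c f)).restrict (contractLeft_mem S c f q)

theorem wedge_mem (r q : ℕ) (ω : KoszulTerm S c r) :
    ∀ x ∈ KoszulTerm S c q,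
      (ω : ExteriorAlgebra S (Fin c → S)) * x ∈ KoszulTerm S c (r + q) := fun x hx => by
  have : (⋀[S]^(r+q) (Fin c → S)) = (⋀[S]^r (Fin c → S)) * (⋀[S]^q (Fin c → S)) := pow_add _ r q
  rw [KoszulTerm, this]
  exact Submodule.mul_mem_mul ω.2 hx

/-- Left exterior multiplication `K_q → K_{r+q}` by an element `ω ∈ K_r`. -/
def wedgeL (r q : ℕ) (ω : KoszulTerm S c r) :
    KoszulTerm S c q →ₗ[S] KoszulTerm S c (r + q) :=
  (LinearMap.mulLeft S (ω : ExteriorAlgebra S (Fin c → S))).restrict (wedge_mem S c r q ω)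

variable (G : ℕ → Type*) [∀ p, AddCommGroup (G p)] [∀ p, Module S (G p)]

/-- The direct sum `⨁_{p,q} G_p ⊗ K_q` housing all the bigraded pieces. -/
abbrev TotalModule := ⨁ (pq : ℕ × ℕ), (G pq.1 ⊗[S] ↥(KoszulTerm S c pq.2))

/-- Inclusion of the `(p,q)` component. -/
abbrev incl (p q : ℕ) : (G p ⊗[S] ↥(KoszulTerm S c q)) →ₗ[S] TotalModule S c G :=
  DirectSum.lof S (ℕ × ℕ) (fun pq => G pq.1 ⊗[S] ↥(KoszulTerm S c pq.2)) (p, q)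

/-- Projection onto the `(p,q)` component. -/
abbrev proj (p q : ℕ) : TotalModule S c G →ₗ[S] (G p ⊗[S] ↥(KoszulTerm S c q)) :=
  DirectSum.component S (ℕ × ℕ) (fun pq => G pq.1 ⊗[S] ↥(KoszulTerm S c pq.2)) (p, q)

/-- A system of higher CI operators on `G` (relative to the Koszul complex of `f`), encoded by
its total maps `T i` of bidegree `(−i, i−1)` on `⨁_{p,q} G_p ⊗ K_q`.  The component
`t_i^{p,q} : G_p ⊗ K_q → G_{p−i} ⊗ K_{q+i−1}` of `T i` is defined for `i ≤ p`; `T i` vanishes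
on the components with `p < i`.  Conditions `zeroth`, `first`, `quadratic` are conditions
(a), (b), (d) of the definition. -/
structure IsHigherCISystem (f : Fin c → S) (t1' : ∀ p, G (p + 1) →ₗ[S] G p)
    (T : ℕ → TotalModule S c G →ₗ[S] TotalModule S c G) : Prop where
  support : ∀ i p q, p < i → ∀ x : G p ⊗[S] ↥(KoszulTerm S c q),
    T i (incl S c G p q x) = 0
  bidegree : ∀ i p q, i ≤ p → ∀ x : G p ⊗[S] ↥(KoszulTerm S c q),
    T i (incl S c G p q x) ∈ LinearMap.range (incl S c G (p - i) (q + i - 1))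
  zeroth : ∀ p q (x : G p ⊗[S] ↥(KoszulTerm S c q)),
    T 0 (incl S c G p q x) =
      incl S c G p (q - 1) (((-1 : S) ^ p) • (LinearMap.lTensor (G p) (koszulD S c f q)) x)
  first : ∀ p q (x : G (p + 1) ⊗[S] ↥(KoszulTerm S c q)),
    T 1 (incl S c G (p + 1) q x) =
      incl S c G p q ((LinearMap.rTensor (↥(KoszulTerm S c q)) (t1' p)) x)
  quadratic : ∀ n, ∑ i ∈ Finset.range (n + 1), (T i).comp (T (n - i)) = 0

/-- Condition (c): the operators `t_i` (`i ≥ 1`) commute with the natural action of `⋀ S^c`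
on the Koszul complex, i.e. `t_i (g ⊗ (ω ∧ η)) = (id ⊗ (ω ∧ ·)) (t_i (g ⊗ η))`. -/
def EquivariantSystem (T : ℕ → TotalModule S c G →ₗ[S] TotalModule S c G) : Prop :=
  ∀ i, 1 ≤ i → ∀ p q r (ω : ↥(KoszulTerm S c r)) (g : G p) (η : ↥(KoszulTerm S c q)),
    T i (incl S c G p (r + q) (g ⊗ₜ[S] wedgeL S c r q ω η)) =
      incl S c G (p - i) (r + (q + i - 1))
        ((LinearMap.lTensor (G (p - i)) (wedgeL S c r (q + i - 1) ω))
          (proj S c G (p - i) (q + i - 1) (T i (incl S c G p q (g ⊗ₜ[S] η)))))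

/-- `f 0, …, f (c−1)` is a regular sequence: each `f j` is a nonzerodivisor modulo the
preceding ones, and `(f 0, …, f (c−1)) ≠ S`. -/
def IsRegularSeq {S : Type*} [CommRing S] {c : ℕ} (f : Fin c → S) : Prop :=
  (∀ j : Fin c, ∀ r : S,
      f j * r ∈ Ideal.span (f '' {i | i < j}) → r ∈ Ideal.span (f '' {i | i < j})) ∧
  Ideal.span (Set.range f) ≠ ⊤

/-- The total differential of the complex `GK`: on the component `G_p ⊗ K_q` it is the sum of
the higher CI operators `t_i^{p,q}` for `0 ≤ i ≤ p`. -/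
def totalD (T : ℕ → TotalModule S c G →ₗ[S] TotalModule S c G) :
    TotalModule S c G →ₗ[S] TotalModule S c G :=
  DirectSum.toModule S (ℕ × ℕ) (TotalModule S c G)
    (fun pq => ∑ i ∈ Finset.range (pq.1 + 1), (T i).comp (incl S c G pq.1 pq.2))

/-- The degree-`m` part `GK_m = ⊕_{p+q=m} G_p ⊗ K_q` of the total complex, as a submodule of
the total module. -/
def degreePart (m : ℕ) : Submodule S (TotalModule S c G) :=
  ⨆ (pq : ℕ × ℕ) (_ : pq.1 + pq.2 = m), LinearMap.range (incl S c G pq.1 pq.2)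

section Koszul

variable {S c}

/-- Contraction on the exterior algebra of `S^c` against a linear form. -/
abbrev contr (d : Module.Dual S (Fin c → S)) :
    ExteriorAlgebra S (Fin c → S) →ₗ[S] ExteriorAlgebra S (Fin c → S) :=
  CliffordAlgebra.contractLeft (Q := (0 : QuadraticForm S (Fin c → S))) d

/-- The `i`-th standard basis vector of `S^c`, inside the exterior algebra. -/
abbrev extBasis (i : Fin c) : ExteriorAlgebra S (Fin c → S) :=
  ExteriorAlgebra.ι S (Pi.single i 1)

theorem koszulForm_apply (f v : Fin c → S) : koszulForm S c f v = ∑ i, f i * v i := by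
  simp [koszulForm]

theorem koszulForm_basis (f : Fin c → S) (j : Fin c) :
    koszulForm S c f (Pi.single j 1) = f j := by
  simp [koszulForm_apply, Pi.single_apply]

theorem koszulForm_single (i : Fin c) :
    koszulForm S c (Pi.single i 1) = LinearMap.proj i := by
  ext j
  simp [koszulForm_basis, Pi.single_apply, eq_comm]

theorem contr_extBasis_mul (d : Module.Dual S (Fin c → S)) (j : Fin c)
    (x : ExteriorAlgebra S (Fin c → S)) :
    contr d (extBasis j * x) = d (Pi.single j 1) • x - extBasis j * contr d x :=
  CliffordAlgebra.contractLeft_ι_mul _ _ _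

theorem contr_contr (d : Module.Dual S (Fin c → S)) (x : ExteriorAlgebra S (Fin c → S)) :
    contr d (contr d x) = 0 :=
  CliffordAlgebra.contractLeft_contractLeft _ _

theorem contr_comm (d d' : Module.Dual S (Fin c → S)) (x : ExteriorAlgebra S (Fin c → S)) :
    contr d (contr d' x) = -contr d' (contr d x) :=
  CliffordAlgebra.contractLeft_comm _ _ _

theorem contr_algebraMap (d : Module.Dual S (Fin c → S)) (r : S) :
    contr d (algebraMap S _ r) = 0 :=
  CliffordAlgebra.contractLeft_algebraMap _ _ _

theorem contr_ι (d : Module.Dual S (Fin c → S)) (v : Fin c → S) :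
    contr d (ExteriorAlgebra.ι S v) = algebraMap S _ (d v) :=
  CliffordAlgebra.contractLeft_ι _ _ _

theorem contr_proj_mem (i : Fin c) (q : ℕ) {x : ExteriorAlgebra S (Fin c → S)}
    (hx : x ∈ KoszulTerm S c q) : contr (LinearMap.proj i) x ∈ KoszulTerm S c (q - 1) := by
  rw [← koszulForm_single]
  exact contractLeft_mem S c _ q x hx

theorem koszulTerm_succ (q : ℕ) : KoszulTerm S c (q + 1) =
    LinearMap.range (ExteriorAlgebra.ι S (M := Fin c → S)) * KoszulTerm S c q :=
  pow_succ' _ _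

theorem ι_mul_mem (v : Fin c → S) (q : ℕ) {x : ExteriorAlgebra S (Fin c → S)}
    (hx : x ∈ KoszulTerm S c q) : ExteriorAlgebra.ι S v * x ∈ KoszulTerm S c (q + 1) := by
  rw [koszulTerm_succ]
  exact Submodule.mul_mem_mul ⟨v, rfl⟩ hx

theorem mem_koszulTerm_zero {x : ExteriorAlgebra S (Fin c → S)} :
    x ∈ KoszulTerm S c 0 ↔ ∃ r, algebraMap S _ r = x := by
  change x ∈ LinearMap.range (ExteriorAlgebra.ι S (M := Fin c → S)) ^ 0 ↔ _
  rw [pow_zero, Submodule.mem_one]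

theorem mem_koszulTerm_one {x : ExteriorAlgebra S (Fin c → S)} :
    x ∈ KoszulTerm S c 1 ↔ ∃ v, ExteriorAlgebra.ι S v = x := by
  change x ∈ LinearMap.range (ExteriorAlgebra.ι S (M := Fin c → S)) ^ 1 ↔ _
  rw [pow_one, LinearMap.mem_range]

theorem exists_projection_killing (s : Finset (Fin c)) :
    ∃ P : ExteriorAlgebra S (Fin c → S) →ₗ[S] ExteriorAlgebra S (Fin c → S),
      (∀ x, (∀ i : Fin c, contr (LinearMap.proj i) x = 0) → P x = x) ∧
      ∀ i ∈ s, ∀ y, P (extBasis i * y) = 0 := by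
  induction s using Finset.induction_on with
  | empty => exact ⟨LinearMap.id, by simp, by simp⟩
  | insert k s hk ih =>
    obtain ⟨P, hP, hP'⟩ := ih
    refine ⟨P ∘ₗ contr (LinearMap.proj k) ∘ₗ LinearMap.mulLeft S (extBasis k), ?_, ?_⟩
    · intro x hx
      have h := contr_extBasis_mul (LinearMap.proj k) k x
      simp only [hx k, mul_zero, sub_zero, LinearMap.proj_apply, Pi.single_eq_same,
        one_smul] at h
      simp only [LinearMap.comp_apply, LinearMap.mulLeft_apply, h, hP x hx]
    · intro i hi y
      simp only [LinearMap.comp_apply, LinearMap.mulLeft_apply]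
      by_cases hik : i = k
      · subst hik
        rw [← mul_assoc, ExteriorAlgebra.ι_sq_zero, zero_mul, map_zero, map_zero]
      · have his : i ∈ s := (Finset.mem_insert.mp hi).resolve_left hik
        have hanti : extBasis k * (extBasis i * y) = -(extBasis i * (extBasis k * y)) := by
          rw [← mul_assoc, ← mul_assoc, ← neg_mul, eq_neg_of_add_eq_zero_left
            (ExteriorAlgebra.ι_add_mul_swap (R := S) (Pi.single k 1) (Pi.single i 1))]
        rw [hanti, map_neg, contr_extBasis_mul]
        simp [Ne.symm hik, hP' i his]

theorem eq_zero_of_contr_eq_zero (q : ℕ) {x : ExteriorAlgebra S (Fin c → S)}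
    (hx : x ∈ KoszulTerm S c (q + 1))
    (h : ∀ i : Fin c, contr (LinearMap.proj i) x = 0) : x = 0 := by
  obtain ⟨P, hP, hP'⟩ := exists_projection_killing (S := S) (c := c) Finset.univ
  rw [← hP x h]
  rw [koszulTerm_succ] at hx
  refine Submodule.mul_induction_on hx ?_ fun y z hy hz => by rw [map_add, hy, hz, add_zero]
  rintro _ ⟨v, rfl⟩ y -
  have hv : v = ∑ i, v i • Pi.single i (1 : S) := by
    ext j
    simp [Finset.sum_apply, Pi.single_apply]
  rw [hv, map_sum, Finset.sum_mul, map_sum]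
  refine Finset.sum_eq_zero fun i _ => ?_
  rw [map_smul, smul_mul_assoc, map_smul, hP' i (Finset.mem_univ i), smul_zero]

theorem exists_koszulForm_eq_of_mem_span (f : Fin c → S) (j : Fin c) {s : S}
    (hs : s ∈ Ideal.span (f '' {i | i < j})) :
    ∃ w : Fin c → S, (∀ i, j ≤ i → w i = 0) ∧ koszulForm S c f w = s := by
  induction hs using Submodule.span_induction with
  | mem x hx =>
    obtain ⟨k, hk, rfl⟩ := hx
    refine ⟨Pi.single k 1, fun i hi => ?_, koszulForm_basis f k⟩
    exact Pi.single_eq_of_ne (ne_of_gt (lt_of_lt_of_le hk hi)) _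
  | zero => exact ⟨0, by simp, map_zero _⟩
  | add x y _ _ hx hy =>
    obtain ⟨v, hv, rfl⟩ := hx
    obtain ⟨w, hw, rfl⟩ := hy
    exact ⟨v + w, fun i hi => by simp [hv i hi, hw i hi], map_add _ _ _⟩
  | smul a x _ hx =>
    obtain ⟨v, hv, rfl⟩ := hx
    exact ⟨a • v, fun i hi => by simp [hv i hi], map_smul _ _ _⟩

theorem koszulForm_mem_span (f : Fin c → S) (j : Fin c) {v : Fin c → S}
    (hv : ∀ i, j ≤ i → v i = 0) : koszulForm S c f v ∈ Ideal.span (f '' {i | i < j}) := by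
  rw [koszulForm_apply]
  refine Ideal.sum_mem _ fun i _ => ?_
  by_cases h : i < j
  · exact Ideal.mul_mem_right _ _ (Ideal.subset_span ⟨i, h, rfl⟩)
  · simp [hv i (not_lt.mp h)]

/-- The acyclicity of the Koszul complex on `f_1, …, f_j`, realised as the part of the exterior
algebra of `S^c` annihilated by the contractions against the last `c - j` coordinates. -/
theorem exists_contr_eq_of_truncated (f : Fin c → S)
    (hf : ∀ j : Fin c, ∀ r : S,
      f j * r ∈ Ideal.span (f '' {i | i < j}) → r ∈ Ideal.span (f '' {i | i < j}))
    (j : ℕ) (hj : j ≤ c) (q : ℕ) {x : ExteriorAlgebra S (Fin c → S)}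
    (hx : x ∈ KoszulTerm S c (q + 1))
    (hxj : ∀ i : Fin c, j ≤ i → contr (LinearMap.proj i) x = 0)
    (hdx : contr (koszulForm S c f) x = 0) :
    ∃ y ∈ KoszulTerm S c (q + 2),
      (∀ i : Fin c, j ≤ i → contr (LinearMap.proj i) y = 0) ∧
      contr (koszulForm S c f) y = x := by
  induction j generalizing q x with
  | zero =>
    refine ⟨0, zero_mem _, fun i _ => map_zero _, ?_⟩
    rw [map_zero, eq_zero_of_contr_eq_zero q hx fun i => hxj i (Nat.zero_le _)]
  | succ j ih =>
    let k : Fin c := ⟨j, hj⟩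
    have hlt : ∀ i : Fin c, j ≤ i → i = k ∨ (j + 1 ≤ i ∧ i ≠ k) := fun i hi => by
      by_cases h : i = k
      · exact Or.inl h
      · exact Or.inr ⟨Nat.lt_of_le_of_ne hi fun h' => h (Fin.ext h'.symm), h⟩
    let b := contr (LinearMap.proj k) x
    have hb : b ∈ KoszulTerm S c q := contr_proj_mem k (q + 1) hx
    have hbj : ∀ i : Fin c, j ≤ i → contr (LinearMap.proj i) b = 0 := by
      intro i hi
      rcases hlt i hi with rfl | ⟨h, -⟩
      · exact contr_contr _ _
      · rw [contr_comm, hxj i h, map_zero, neg_zero]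
    have hdb : contr (koszulForm S c f) b = 0 := by
      rw [contr_comm, hdx, map_zero, neg_zero]
    have haj : ∀ i : Fin c, j ≤ i → contr (LinearMap.proj i) (x - extBasis k * b) = 0 := by
      intro i hi
      rw [map_sub, contr_extBasis_mul, hbj i hi]
      rcases hlt i hi with rfl | ⟨h, hne⟩
      · simp [b]
      · simp [hxj i h, hne]
    have hda : contr (koszulForm S c f) (x - extBasis k * b) = -(f k • b) := by
      rw [map_sub, contr_extBasis_mul, hdx, hdb, koszulForm_basis, mul_zero, sub_zero, zero_sub]
    obtain ⟨b', hb', hb'j, hdb'⟩ : ∃ b' ∈ KoszulTerm S c (q + 1),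
        (∀ i : Fin c, j ≤ i → contr (LinearMap.proj i) b' = 0) ∧
        contr (koszulForm S c f) b' = b := by
      match q, hx, hb with
      | q + 1, hx, hb => exact ih (Nat.le_of_succ_le hj) q hb hbj hdb
      | 0, hx, hb =>
        obtain ⟨s, hs⟩ := mem_koszulTerm_zero.mp hb
        obtain ⟨v, hv⟩ := mem_koszulTerm_one.mp (sub_mem hx (ι_mul_mem (Pi.single k 1) 0 hb))
        rw [← hv, contr_ι, ← hs, Algebra.smul_def, ← map_mul, ← map_neg,
          ExteriorAlgebra.algebraMap_inj] at hda
        have hvk : ∀ i, k ≤ i → v i = 0 := fun i hi => by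
          have := haj i hi
          rw [← hv, contr_ι] at this
          exact (ExteriorAlgebra.algebraMap_eq_zero_iff _ _).mp this
        have hmem := neg_mem (koszulForm_mem_span f k hvk)
        rw [hda, neg_neg] at hmem
        obtain ⟨w, hw, hws⟩ := exists_koszulForm_eq_of_mem_span f k (hf k s hmem)
        refine ⟨ExteriorAlgebra.ι S w, mem_koszulTerm_one.mpr ⟨w, rfl⟩, fun i hi => ?_, ?_⟩
        · rw [contr_ι, LinearMap.proj_apply, hw i hi, map_zero]
        · rw [contr_ι, hws, hs]
    have hdeb : contr (koszulForm S c f) (extBasis k * b') = f k • b' - extBasis k * b := by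
      rw [contr_extBasis_mul, koszulForm_basis, hdb']
    obtain ⟨y, hy, hyj, hdy⟩ := ih (Nat.le_of_succ_le hj) q
      (x := x - extBasis k * b + f k • b')
      (add_mem (sub_mem hx (ι_mul_mem _ q hb)) (Submodule.smul_mem _ _ hb'))
      (fun i hi => by rw [map_add, haj i hi, map_smul, hb'j i hi, smul_zero, add_zero])
      (by rw [map_add, hda, map_smul, hdb', neg_add_cancel])
    refine ⟨y - extBasis k * b', sub_mem hy (ι_mul_mem _ _ hb'), fun i hi => ?_, ?_⟩
    · have hik : i ≠ k := fun h => by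
        rw [h] at hi
        exact absurd hi (Nat.not_succ_le_self j)
      rw [map_sub, hyj i (Nat.le_of_succ_le hi), contr_extBasis_mul,
        hb'j i (Nat.le_of_succ_le hi)]
      simp [hik]
    · rw [map_sub, hdy, hdeb]
      abel

theorem koszulD_exact {f : Fin c → S} (hf : IsRegularSeq f) (q : ℕ) :
    Function.Exact (koszulD S c f (q + 2) : KoszulTerm S c (q + 2) →ₗ[S] KoszulTerm S c (q + 1))
      (koszulD S c f (q + 1) : KoszulTerm S c (q + 1) →ₗ[S] KoszulTerm S c q) := by
  intro x
  constructor
  · intro hx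
    obtain ⟨y, hy, -, hdy⟩ := exists_contr_eq_of_truncated f hf.1 c le_rfl q x.2
      (fun i hi => absurd i.2 (not_lt.mpr hi)) (congrArg Subtype.val hx)
    exact ⟨⟨y, hy⟩, Subtype.ext hdy⟩
  · rintro ⟨y, rfl⟩
    exact Subtype.ext (contr_contr _ _)

/-- The augmentation `K_0 = S → S/I` of the Koszul complex. -/
def koszulAug (f : Fin c → S) : KoszulTerm S c 0 →ₗ[S] S ⧸ Ideal.span (Set.range f) :=
  (Ideal.span (Set.range f)).mkQ ∘ₗ ExteriorAlgebra.algebraMapInv.toLinearMap ∘ₗ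
    (KoszulTerm S c 0).subtype

theorem koszulAug_surjective (f : Fin c → S) : Function.Surjective (koszulAug f) := by
  intro r
  obtain ⟨s, rfl⟩ := Submodule.mkQ_surjective _ r
  refine ⟨⟨algebraMap S _ s, mem_koszulTerm_zero.mpr ⟨s, rfl⟩⟩, ?_⟩
  simp [koszulAug, ExteriorAlgebra.algebraMap_leftInverse (Fin c → S) s]

theorem koszulAug_exact (f : Fin c → S) :
    Function.Exact (koszulD S c f 1 : KoszulTerm S c 1 →ₗ[S] KoszulTerm S c 0)
      (koszulAug f) := by
  have hrange : Ideal.span (Set.range f) = LinearMap.range (koszulForm S c f) := by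
    refine le_antisymm (Ideal.span_le.mpr ?_) ?_
    · rintro _ ⟨i, rfl⟩
      exact ⟨Pi.single i 1, koszulForm_basis f i⟩
    · rintro _ ⟨v, rfl⟩
      rw [koszulForm_apply]
      exact Ideal.sum_mem _ fun i _ => Ideal.mul_mem_right _ _ (Ideal.subset_span ⟨i, rfl⟩)
  rintro ⟨x, hx⟩
  obtain ⟨s, rfl⟩ := mem_koszulTerm_zero.mp hx
  have h1 : koszulAug f ⟨algebraMap S _ s, hx⟩ = (Ideal.span (Set.range f)).mkQ s := by
    simp [koszulAug, ExteriorAlgebra.algebraMap_leftInverse (Fin c → S) s]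
  rw [h1, Submodule.mkQ_apply, Submodule.Quotient.mk_eq_zero, hrange]
  constructor
  · rintro ⟨v, rfl⟩
    exact ⟨⟨_, mem_koszulTerm_one.mpr ⟨v, rfl⟩⟩, Subtype.ext (contr_ι _ v)⟩
  · rintro ⟨⟨y, hy⟩, hyx⟩
    obtain ⟨v, rfl⟩ := mem_koszulTerm_one.mp hy
    refine ⟨v, ?_⟩
    have := congrArg Subtype.val hyx
    exact (ExteriorAlgebra.algebraMap_inj _ _ _).mp ((contr_ι _ v).symm.trans this)

end Koszul

/-- A partial sum of free summands of a direct sum is free. -/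
theorem free_iSup_range_lof (R : Type*) [CommRing R] {ι : Type*} [DecidableEq ι] (N : ι → Type*)
    [∀ i, AddCommGroup (N i)] [∀ i, Module R (N i)] [∀ i, Module.Free R (N i)]
    (P : ι → Prop) :
    Module.Free R ↥(⨆ (i : ι) (_ : P i), LinearMap.range (DirectSum.lof R ι N i)) := by
  let φ : (⨁ i : {i // P i}, N i) →ₗ[R] ⨁ i, N i :=
    DirectSum.toModule R _ _ fun i => DirectSum.lof R ι N i
  have hcomp : ∀ (i : {i // P i}) (x), DirectSum.component R ι N i (φ x) =
      DirectSum.component R {i // P i} (fun i => N i) i x := by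
    intro i x
    refine LinearMap.congr_fun (f := (DirectSum.component R ι N i).comp φ) ?_ x
    refine DirectSum.linearMap_ext R fun j => LinearMap.ext fun y => ?_
    simp only [LinearMap.comp_apply, φ, DirectSum.toModule_lof]
    by_cases h : j = i
    · subst h
      rw [DirectSum.component.lof_self, DirectSum.component.lof_self]
    · rw [DirectSum.component.of, DirectSum.component.of, dif_neg h,
        dif_neg fun h' => h (Subtype.ext h')]
  have hinj : Function.Injective φ := fun x y hxy =>
    DirectSum.ext_component R fun i => by rw [← hcomp, ← hcomp, hxy]
  have hrange : LinearMap.range φ =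
      ⨆ (i : ι) (_ : P i), LinearMap.range (DirectSum.lof R ι N i) := by
    refine le_antisymm ?_ (iSup_le fun i => iSup_le fun hi => ?_)
    · rintro _ ⟨x, rfl⟩
      induction x using DirectSum.induction_on with
      | zero => rw [map_zero]; exact zero_mem _
      | of i y =>
        have h : φ (DirectSum.of _ i y) = DirectSum.lof R ι N i y :=
          DirectSum.toModule_lof (M := fun i : {i // P i} => N i) R i y
        rw [h]
        exact Submodule.mem_iSup_of_mem i.1 (Submodule.mem_iSup_of_mem i.2 ⟨y, rfl⟩)
      | add x y hx hy => rw [map_add]; exact add_mem hx hy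
    · rintro _ ⟨x, rfl⟩
      exact ⟨DirectSum.lof R {i // P i} (fun i => N i) ⟨i, hi⟩ x, DirectSum.toModule_lof R _ _⟩
  exact Module.Free.of_equiv ((LinearEquiv.ofInjective φ hinj).trans (LinearEquiv.ofEq _ _ hrange))

section Augmentation

variable {S c} {G} (f : Fin c → S)

/-- The augmentation `G_p ⊗ K_0 → R ⊗ G_p` induced by `K_0 = S → R`. -/
def tensorAug (p : ℕ) :
    G p ⊗[S] KoszulTerm S c 0 →ₗ[S] (S ⧸ Ideal.span (Set.range f)) ⊗[S] G p :=
  (TensorProduct.comm S _ _).toLinearMap ∘ₗ LinearMap.lTensor (G p) (koszulAug f)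

theorem tensorAug_surjective (p : ℕ) : Function.Surjective (tensorAug (G := G) f p) :=
  (TensorProduct.comm S _ _).surjective.comp
    (LinearMap.lTensor_surjective _ (koszulAug_surjective f))

theorem tensorAug_exact (p : ℕ) :
    Function.Exact
      (LinearMap.lTensor (G p) (koszulD S c f 1 : KoszulTerm S c 1 →ₗ[S] KoszulTerm S c 0))
      (tensorAug f p) := by
  intro x
  rw [← lTensor_exact (G p) (koszulAug_exact f) (koszulAug_surjective f) x]
  exact (TensorProduct.comm S _ _).map_eq_zero_iff

theorem tensorAug_rTensor (t1' : ∀ p, G (p + 1) →ₗ[S] G p) (p : ℕ)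
    (x : G (p + 1) ⊗[S] KoszulTerm S c 0) :
    tensorAug f p (LinearMap.rTensor _ (t1' p) x) =
      LinearMap.baseChange (S ⧸ Ideal.span (Set.range f)) (t1' p) (tensorAug f (p + 1) x) := by
  induction x using TensorProduct.induction_on with
  | zero => simp only [map_zero]
  | tmul g k => simp [tensorAug]
  | add x y hx hy => simp only [map_add, hx, hy]

theorem exists_add_eq_of_tensorAug_mem_range (t1' : ∀ p, G (p + 1) →ₗ[S] G p) (p : ℕ)
    {a : G p ⊗[S] KoszulTerm S c 0}
    (ha : tensorAug f p a ∈
      LinearMap.range (LinearMap.baseChange (S ⧸ Ideal.span (Set.range f)) (t1' p))) :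
    ∃ (u : G (p + 1) ⊗[S] KoszulTerm S c 0) (v : G p ⊗[S] KoszulTerm S c 1),
      LinearMap.rTensor _ (t1' p) u +
        LinearMap.lTensor (G p)
          (koszulD S c f 1 : KoszulTerm S c 1 →ₗ[S] KoszulTerm S c 0) v = a := by
  obtain ⟨w, hw⟩ := ha
  obtain ⟨u, rfl⟩ := tensorAug_surjective f (p + 1) w
  rw [← tensorAug_rTensor, eq_comm, ← sub_eq_zero, ← map_sub] at hw
  obtain ⟨v, hv⟩ := (tensorAug_exact f p _).mp hw
  exact ⟨u, v, by rw [hv, add_sub_cancel]⟩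

end Augmentation

section Filtration

variable {S c} {G}

variable (S c G) in
/-- The part `⊕_{p+q=m, p<P} G_p ⊗ K_q` of the degree-`m` part of the total complex. -/
def columnPart (P m : ℕ) : Submodule S (TotalModule S c G) :=
  ⨆ (pq : ℕ × ℕ) (_ : pq.1 + pq.2 = m ∧ pq.1 < P), LinearMap.range (incl S c G pq.1 pq.2)

theorem incl_mem_columnPart {P m p q : ℕ} (hm : p + q = m) (hP : p < P)
    (x : G p ⊗[S] KoszulTerm S c q) : incl S c G p q x ∈ columnPart S c G P m :=
  Submodule.mem_iSup_of_mem (p, q) (Submodule.mem_iSup_of_mem ⟨hm, hP⟩ ⟨x, rfl⟩)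

theorem columnPart_le {P m : ℕ} {N : Submodule S (TotalModule S c G)}
    (h : ∀ p q, p + q = m → p < P → ∀ x, incl S c G p q x ∈ N) : columnPart S c G P m ≤ N := by
  refine iSup_le fun pq => iSup_le fun hpq => ?_
  rintro _ ⟨x, rfl⟩
  exact h _ _ hpq.1 hpq.2 x

theorem columnPart_mono {P P' : ℕ} (h : P ≤ P') (m : ℕ) :
    columnPart S c G P m ≤ columnPart S c G P' m :=
  columnPart_le fun _ _ hm hP x => incl_mem_columnPart hm (hP.trans_le h) x

theorem columnPart_zero (m : ℕ) : columnPart S c G 0 m = ⊥ :=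
  le_bot_iff.mp (columnPart_le fun _ _ _ hP => absurd hP (Nat.not_lt_zero _))

theorem degreePart_eq_columnPart (m : ℕ) :
    degreePart S c G m = columnPart S c G (m + 1) m := by
  refine le_antisymm (iSup_le fun pq => iSup_le fun hpq => ?_)
    (columnPart_le fun p q hm _ x => ?_)
  · rintro _ ⟨x, rfl⟩
    exact incl_mem_columnPart hpq (by omega) x
  · exact Submodule.mem_iSup_of_mem (p, q) (Submodule.mem_iSup_of_mem hm ⟨x, rfl⟩)

theorem exists_of_mem_columnPart_succ {P q : ℕ} {x : TotalModule S c G}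
    (hx : x ∈ columnPart S c G (P + 1) (P + q)) :
    ∃ x' ∈ columnPart S c G P (P + q), ∃ a, x = x' + incl S c G P q a := by
  have hle : columnPart S c G (P + 1) (P + q) ≤
      columnPart S c G P (P + q) ⊔ LinearMap.range (incl S c G P q) := by
    refine columnPart_le fun p q' hm hP y => ?_
    rcases Nat.lt_succ_iff_lt_or_eq.mp hP with h | rfl
    · exact Submodule.mem_sup_left (incl_mem_columnPart hm h y)
    · obtain rfl : q' = q := by omega
      exact Submodule.mem_sup_right ⟨y, rfl⟩
  obtain ⟨x', hx', _, ⟨a, rfl⟩, rfl⟩ := Submodule.mem_sup.mp (hle hx)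
  exact ⟨x', hx', a, rfl⟩

theorem proj_incl (p q : ℕ) (x : G p ⊗[S] KoszulTerm S c q) :
    proj S c G p q (incl S c G p q x) = x :=
  DirectSum.component.lof_self S _ _

theorem proj_incl_of_ne {p q p' q' : ℕ} (h : (p', q') ≠ (p, q))
    (x : G p' ⊗[S] KoszulTerm S c q') : proj S c G p q (incl S c G p' q' x) = 0 := by
  rw [proj, incl, DirectSum.component.of, dif_neg h]

theorem proj_eq_zero_of_mem_columnPart {P m p q : ℕ} (h : P ≤ p) {x : TotalModule S c G}
    (hx : x ∈ columnPart S c G P m) : proj S c G p q x = 0 := by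
  refine columnPart_le (N := LinearMap.ker (proj S c G p q)) (fun p' q' _ hP y => ?_) hx
  exact proj_incl_of_ne (fun h' => by cases h'; omega) y

theorem free_degreePart [∀ p, Module.Free S (G p)] (m : ℕ) :
    Module.Free S (degreePart S c G m) :=
  free_iSup_range_lof S (fun pq : ℕ × ℕ => G pq.1 ⊗[S] KoszulTerm S c pq.2) _

end Filtration

section TotalDifferential

variable {S c} {G} {f : Fin c → S} {t1' : ∀ p, G (p + 1) →ₗ[S] G p}
  {T : ℕ → TotalModule S c G →ₗ[S] TotalModule S c G}

theorem totalD_incl (p q : ℕ) (x : G p ⊗[S] KoszulTerm S c q) :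
    totalD S c G T (incl S c G p q x) =
      ∑ i ∈ Finset.range (p + 1), T i (incl S c G p q x) := by
  rw [totalD, incl, DirectSum.toModule_lof, LinearMap.sum_apply]
  rfl

namespace IsHigherCISystem

variable (hT : IsHigherCISystem S c G f t1' T)
include hT

theorem totalD_incl_of_lt {p N : ℕ} (hN : p < N) (q : ℕ) (x : G p ⊗[S] KoszulTerm S c q) :
    totalD S c G T (incl S c G p q x) = ∑ i ∈ Finset.range N, T i (incl S c G p q x) := by
  rw [totalD_incl]
  refine Finset.sum_subset (Finset.range_mono hN) fun i _ hi => hT.support i p q ?_ x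
  simpa using hi

theorem apply_mem_columnPart (p q i : ℕ) (x : G p ⊗[S] KoszulTerm S c q) :
    T (i + 1) (incl S c G p q x) ∈ columnPart S c G (p - i) (p + q - 1) := by
  rcases Nat.lt_or_ge p (i + 1) with h | h
  · rw [hT.support _ _ _ h]
    exact zero_mem _
  · obtain ⟨y, hy⟩ := hT.bidegree _ _ q h x
    rw [← hy]
    exact incl_mem_columnPart (by omega) (by omega) y

theorem apply_zero_incl_zero (p : ℕ) (x : G p ⊗[S] KoszulTerm S c 0) :
    T 0 (incl S c G p 0 x) = 0 := by
  have h : koszulD S c f 0 = 0 := by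
    refine LinearMap.ext fun ⟨y, hy⟩ => Subtype.ext ?_
    obtain ⟨r, rfl⟩ := mem_koszulTerm_zero.mp hy
    exact contr_algebraMap _ r
  rw [hT.zeroth, h, LinearMap.lTensor_zero, LinearMap.zero_apply, smul_zero, map_zero]

theorem apply_zero_incl_succ (p q : ℕ) (x : G p ⊗[S] KoszulTerm S c (q + 1)) :
    T 0 (incl S c G p (q + 1) x) =
      incl S c G p q (((-1 : S) ^ p) • LinearMap.lTensor (G p)
        (koszulD S c f (q + 1) : KoszulTerm S c (q + 1) →ₗ[S] KoszulTerm S c q) x) :=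
  hT.zeroth p (q + 1) x

theorem apply_zero_incl_smul (p q : ℕ) (x : G p ⊗[S] KoszulTerm S c (q + 1)) :
    T 0 (incl S c G p (q + 1) ((-1 : S) ^ p • x)) =
      incl S c G p q (LinearMap.lTensor (G p)
        (koszulD S c f (q + 1) : KoszulTerm S c (q + 1) →ₗ[S] KoszulTerm S c q) x) := by
  rw [map_smul, map_smul, hT.apply_zero_incl_succ, ← map_smul, smul_smul, ← mul_pow,
    neg_one_mul, neg_neg, one_pow, one_smul]

theorem totalD_sub_mem (p q : ℕ) (x : G p ⊗[S] KoszulTerm S c q) :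
    totalD S c G T (incl S c G p q x) - T 0 (incl S c G p q x) ∈
      columnPart S c G p (p + q - 1) := by
  rw [totalD_incl, Finset.sum_range_succ', add_sub_cancel_right]
  exact sum_mem fun i _ => columnPart_mono (Nat.sub_le p i) _ (hT.apply_mem_columnPart p q i x)

theorem totalD_incl_succ_sub_mem (p : ℕ) (x : G (p + 1) ⊗[S] KoszulTerm S c 0) :
    totalD S c G T (incl S c G (p + 1) 0 x) -
      incl S c G p 0 (LinearMap.rTensor _ (t1' p) x) ∈ columnPart S c G p p := by
  rw [totalD_incl, Finset.sum_range_succ', Finset.sum_range_succ', hT.apply_zero_incl_zero,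
    add_zero, hT.first, add_sub_cancel_right]
  refine sum_mem fun i _ => columnPart_mono ?_ _ (hT.apply_mem_columnPart (p + 1) 0 (i + 1) x)
  omega

theorem totalD_mem_columnPart {P m : ℕ} {x : TotalModule S c G}
    (hx : x ∈ columnPart S c G P (m + 1)) : totalD S c G T x ∈ columnPart S c G P m := by
  refine columnPart_le (N := (columnPart S c G P m).comap (totalD S c G T))
    (fun p q hm hP y => ?_) hx
  rw [Submodule.mem_comap, ← sub_add_cancel (totalD S c G T _) (T 0 (incl S c G p q y))]
  refine add_mem (columnPart_mono hP.le _ ?_) ?_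
  · simpa [hm] using hT.totalD_sub_mem p q y
  · match q, y with
    | 0, y =>
      rw [hT.apply_zero_incl_zero]
      exact zero_mem _
    | q + 1, y =>
      rw [hT.apply_zero_incl_succ]
      exact incl_mem_columnPart (by omega) hP _

theorem totalD_comp_totalD : (totalD S c G T).comp (totalD S c G T) = 0 := by
  refine DirectSum.linearMap_ext S fun ⟨p, q⟩ => LinearMap.ext fun x => ?_
  change totalD S c G T (totalD S c G T (incl S c G p q x)) = 0
  have hinner : ∀ j, totalD S c G T (T j (incl S c G p q x)) =
      ∑ i ∈ Finset.range (p + 1 - j), T i (T j (incl S c G p q x)) := by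
    intro j
    rcases Nat.lt_or_ge p j with h | h
    · simp [hT.support _ _ _ h]
    · obtain ⟨y, hy⟩ := hT.bidegree _ _ q h x
      rw [← hy, hT.totalD_incl_of_lt (N := p + 1 - j) (by omega)]
  rw [totalD_incl, map_sum, Finset.sum_congr rfl fun j _ => hinner j,
    ← Finset.sum_range_diag_flip (p + 1) fun j i => T i (T j (incl S c G p q x))]
  refine Finset.sum_eq_zero fun n _ => ?_
  have h := LinearMap.congr_fun (hT.quadratic n) (incl S c G p q x)
  rw [LinearMap.sum_apply, LinearMap.zero_apply] at h
  rw [← h, ← Finset.sum_flip]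
  refine Finset.sum_congr rfl fun i hi => ?_
  rw [Nat.sub_sub_self (Nat.lt_succ_iff.mp (Finset.mem_range.mp hi)), LinearMap.comp_apply]

/-- A cycle supported in the columns `< P ≤ m` is the boundary of a chain: its highest component
is killed using the exactness of the rows. -/
theorem exists_totalD_eq_of_mem_columnPart [∀ p, Module.Free S (G p)] (hf : IsRegularSeq f)
    {P m : ℕ} (hP : P ≤ m) {x : TotalModule S c G} (hx : x ∈ columnPart S c G P m)
    (hDx : totalD S c G T x = 0) :
    ∃ y ∈ degreePart S c G (m + 1), totalD S c G T y = x := by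
  induction P generalizing x with
  | zero =>
    rw [columnPart_zero, Submodule.mem_bot] at hx
    exact ⟨0, zero_mem _, by rw [map_zero, hx]⟩
  | succ P ih =>
    obtain ⟨q, rfl⟩ : ∃ q, m = P + (q + 1) := ⟨m - P - 1, by omega⟩
    obtain ⟨x', hx', a, rfl⟩ := exists_of_mem_columnPart_succ hx
    have ha : LinearMap.lTensor (G P)
        (koszulD S c f (q + 1) : KoszulTerm S c (q + 1) →ₗ[S] KoszulTerm S c q) a = 0 := by
      have h1 := proj_eq_zero_of_mem_columnPart (p := P) (q := q) le_rfl
        (add_mem (hT.totalD_mem_columnPart (m := P + q) hx') (hT.totalD_sub_mem P (q + 1) a))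
      rw [← add_sub_assoc, ← map_add, hDx, zero_sub, map_neg, neg_eq_zero,
        hT.apply_zero_incl_succ, proj_incl] at h1
      exact (IsUnit.smul_eq_zero (isUnit_one.neg.pow P)).mp h1
    obtain ⟨b, hb⟩ := (Module.Flat.lTensor_exact (G P) (koszulD_exact hf q) a).mp ha
    let y := incl S c G P (q + 2) ((-1 : S) ^ P • b)
    have hy : y ∈ degreePart S c G (P + (q + 1) + 1) := by
      rw [degreePart_eq_columnPart]
      exact incl_mem_columnPart (by omega) (by omega) _
    have hDy : T 0 y = incl S c G P (q + 1) a := by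
      exact (hT.apply_zero_incl_smul P (q + 1) b).trans (congrArg _ hb)
    obtain ⟨z, hz, hDz⟩ := ih (by omega)
      (x := x' + incl S c G P (q + 1) a - totalD S c G T y) (by
        rw [← hDy, add_sub_assoc, ← neg_sub (totalD S c G T y)]
        exact add_mem hx' (neg_mem (hT.totalD_sub_mem P (q + 2) _)))
      (by rw [map_sub, hDx, ← LinearMap.comp_apply, hT.totalD_comp_totalD, LinearMap.zero_apply,
        sub_zero])
    exact ⟨z + y, add_mem hz hy, by rw [map_add, hDz, sub_add_cancel]⟩

theorem exists_totalD_eq [∀ p, Module.Free S (G p)] (hf : IsRegularSeq f)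
    (hGexact : ∀ p,
      LinearMap.ker (LinearMap.baseChange (S ⧸ Ideal.span (Set.range f)) (t1' p)) =
        LinearMap.range (LinearMap.baseChange (S ⧸ Ideal.span (Set.range f)) (t1' (p + 1))))
    {m : ℕ} {x : TotalModule S c G} (hx : x ∈ degreePart S c G (m + 1))
    (hDx : totalD S c G T x = 0) :
    ∃ y ∈ degreePart S c G (m + 2), totalD S c G T y = x := by
  rw [degreePart_eq_columnPart] at hx
  obtain ⟨x', hx', a, rfl⟩ := exists_of_mem_columnPart_succ (P := m + 1) (q := 0) hx
  obtain ⟨x'', hx'', b, rfl⟩ := exists_of_mem_columnPart_succ (P := m) (q := 1) hx'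
  have ha : LinearMap.lTensor (G m)
        (koszulD S c f 1 : KoszulTerm S c 1 →ₗ[S] KoszulTerm S c 0) ((-1 : S) ^ m • b) +
      LinearMap.rTensor _ (t1' m) a = 0 := by
    have h1 := proj_eq_zero_of_mem_columnPart (p := m) (q := 0) le_rfl
      (add_mem (add_mem (hT.totalD_mem_columnPart (m := m) hx'') (hT.totalD_sub_mem m 1 b))
        (hT.totalD_incl_succ_sub_mem m a))
    rw [← add_sub_assoc, ← add_sub_assoc, ← map_add, sub_add_eq_add_sub, ← map_add, hDx,
      sub_sub, zero_sub, map_neg, neg_eq_zero, map_add, hT.apply_zero_incl_succ, proj_incl,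
      proj_incl, ← map_smul] at h1
    exact h1
  obtain ⟨u, v, huv⟩ := exists_add_eq_of_tensorAug_mem_range f t1' (m + 1) (a := a) (by
    rw [← hGexact, LinearMap.mem_ker, ← tensorAug_rTensor, eq_neg_of_add_eq_zero_right ha,
      map_neg, neg_eq_zero]
    exact (tensorAug_exact f m _).mpr ⟨_, rfl⟩)
  let y := incl S c G (m + 2) 0 u
  let z := incl S c G (m + 1) 1 ((-1 : S) ^ (m + 1) • v)
  have hy : y ∈ degreePart S c G (m + 2) := by
    rw [degreePart_eq_columnPart]
    exact incl_mem_columnPart (by omega) (by omega) _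
  have hz : z ∈ degreePart S c G (m + 2) := by
    rw [degreePart_eq_columnPart]
    exact incl_mem_columnPart (by omega) (by omega) _
  have hTz : T 0 z = incl S c G (m + 1) 0 (LinearMap.lTensor (G (m + 1))
      (koszulD S c f 1 : KoszulTerm S c 1 →ₗ[S] KoszulTerm S c 0) v) := by
    exact hT.apply_zero_incl_smul (m + 1) 0 v
  have hmem := sub_mem hx' (add_mem (hT.totalD_incl_succ_sub_mem (m + 1) u)
    (hT.totalD_sub_mem (m + 1) 1 ((-1 : S) ^ (m + 1) • v)))
  obtain ⟨w, hw, hDw⟩ := hT.exists_totalD_eq_of_mem_columnPart hf (P := m + 1) (m := m + 1) le_rfl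
    (x := x'' + incl S c G m 1 b + incl S c G (m + 1) 0 a - totalD S c G T (y + z)) (by
      convert hmem using 1
      rw [← huv, hTz, map_add, map_add]
      abel)
    (by rw [map_sub, hDx, ← LinearMap.comp_apply, hT.totalD_comp_totalD, LinearMap.zero_apply,
      sub_zero])
  exact ⟨w + (y + z), add_mem hw (add_mem hy hz), by rw [map_add, hDw, sub_add_cancel]⟩

theorem proj_totalD_incl_one_zero (x : G 1 ⊗[S] KoszulTerm S c 0) :
    proj S c G 0 0 (totalD S c G T (incl S c G 1 0 x)) = LinearMap.rTensor _ (t1' 0) x := by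
  have h := proj_eq_zero_of_mem_columnPart (p := 0) (q := 0) le_rfl
    (hT.totalD_incl_succ_sub_mem 0 x)
  rwa [map_sub, proj_incl, sub_eq_zero] at h

theorem proj_totalD_incl_zero_one (x : G 0 ⊗[S] KoszulTerm S c 1) :
    proj S c G 0 0 (totalD S c G T (incl S c G 0 1 x)) =
      LinearMap.lTensor (G 0)
        (koszulD S c f 1 : KoszulTerm S c 1 →ₗ[S] KoszulTerm S c 0) x := by
  have h := proj_eq_zero_of_mem_columnPart (p := 0) (q := 0) le_rfl (hT.totalD_sub_mem 0 1 x)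
  rwa [map_sub, hT.apply_zero_incl_succ, proj_incl, sub_eq_zero, pow_zero, one_smul] at h

end IsHigherCISystem

end TotalDifferential

/-- Let `f_1, …, f_c` be a regular sequence generating `I ⊆ S`, let
`R = S/I`, and let `(G, t_1')` be as above, such that `R ⊗ G` is a free resolution of an
`R`-module `M`.  Then for any system of higher CI operators on `G`, the total complex `GK`
(with `GK_m = ⊕_{p+q=m} G_p ⊗ K_q` and differential `totalD`) is a free resolution of `M`
over `S`: the total differential has degree `−1` and squares to zero, each `GK_m` is a free
`S`-module, `coker(GK_1 → GK_0) ≅ M`, and `H_m(GK) = 0` for `m ≥ 1`. -/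
theorem stmt9 {S : Type*} [CommRing S] {c : ℕ} (f : Fin c → S)
    (hreg : IsRegularSeq f)
    (G : ℕ → Type*) [∀ p, AddCommGroup (G p)] [∀ p, Module S (G p)]
    [∀ p, Module.Free S (G p)]
    (t1' : ∀ p, G (p + 1) →ₗ[S] G p)
    (hsq : ∀ p (x : G (p + 2)),
      t1' p (t1' (p + 1) x) ∈
        Ideal.span (Set.range f) • (⊤ : Submodule S (G p)))
    -- `M` is a module over `R = S/I`, and also over `S` via restriction of scalars
    (M : Type*) [AddCommGroup M] [Module S M]
    [Module (S ⧸ Ideal.span (Set.range f)) M]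
    [IsScalarTower S (S ⧸ Ideal.span (Set.range f)) M]
    -- `R ⊗ G`, with the differentials induced by `t1'`, is a free resolution of `M` over `R`
    (π : ((S ⧸ Ideal.span (Set.range f)) ⊗[S] G 0) →ₗ[S ⧸ Ideal.span (Set.range f)] M)
    (hπsurj : Function.Surjective π)
    (hπker : LinearMap.ker π =
      LinearMap.range (LinearMap.baseChange (S ⧸ Ideal.span (Set.range f)) (t1' 0)))
    (hGexact : ∀ p,
      LinearMap.ker (LinearMap.baseChange (S ⧸ Ideal.span (Set.range f)) (t1' p)) =
        LinearMap.range (LinearMap.baseChange (S ⧸ Ideal.span (Set.range f)) (t1' (p + 1))))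
    -- a system of higher CI operators on `G`
    (T : ℕ → TotalModule S c G →ₗ[S] TotalModule S c G)
    (hT : IsHigherCISystem S c G f t1' T) :
    -- the total differential has degree `−1` ...
    (∀ m, ∀ x ∈ degreePart S c G (m + 1), totalD S c G T x ∈ degreePart S c G m) ∧
    -- ... and `GK` is a complex
    ((totalD S c G T).comp (totalD S c G T) = 0) ∧
    -- each term `GK_m` is a free `S`-module
    (∀ m, Module.Free S ↥(degreePart S c G m)) ∧
    -- the cokernel of `T_1 : GK_1 → GK_0` is `M`
    (∃ ε : (G 0 ⊗[S] ↥(KoszulTerm S c 0)) →ₗ[S] M,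
      Function.Surjective ε ∧
      LinearMap.ker ε =
        LinearMap.range ((proj S c G 0 0).comp ((totalD S c G T).comp (incl S c G 1 0))) ⊔
        LinearMap.range ((proj S c G 0 0).comp ((totalD S c G T).comp (incl S c G 0 1)))) ∧
    -- `H_m(GK) = 0` for all `m ≥ 1`
    (∀ m, 1 ≤ m → ∀ x ∈ degreePart S c G m, totalD S c G T x = 0 →
      ∃ y ∈ degreePart S c G (m + 1), totalD S c G T y = x) := by
  refine ⟨fun m x hx => ?_, hT.totalD_comp_totalD, free_degreePart, ?_, fun m hm x hx hDx => ?_⟩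
  · rw [degreePart_eq_columnPart] at hx ⊢
    have h := hT.totalD_mem_columnPart hx
    refine columnPart_le (N := columnPart S c G (m + 1) m) (fun p q hpq _ y => ?_) h
    exact incl_mem_columnPart hpq (by omega) y
  · refine ⟨π.restrictScalars S ∘ₗ tensorAug f 0, hπsurj.comp (tensorAug_surjective f 0),
      le_antisymm (fun a ha => ?_) (sup_le ?_ ?_)⟩
    · have ha' : tensorAug f 0 a ∈ LinearMap.ker π := ha
      rw [hπker] at ha'
      obtain ⟨u, v, rfl⟩ := exists_add_eq_of_tensorAug_mem_range f t1' 0 ha'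
      exact Submodule.add_mem_sup ⟨u, hT.proj_totalD_incl_one_zero u⟩
        ⟨v, hT.proj_totalD_incl_zero_one v⟩
    · rintro _ ⟨u, rfl⟩
      change tensorAug f 0 (proj S c G 0 0 (totalD S c G T (incl S c G 1 0 u))) ∈ LinearMap.ker π
      rw [hT.proj_totalD_incl_one_zero, hπker, tensorAug_rTensor]
      exact ⟨_, rfl⟩
    · rintro _ ⟨v, rfl⟩
      change tensorAug f 0 (proj S c G 0 0 (totalD S c G T (incl S c G 0 1 v))) ∈ LinearMap.ker π
      rw [hT.proj_totalD_incl_zero_one, (tensorAug_exact f 0 _).mpr ⟨v, rfl⟩]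
      exact zero_mem _
  · obtain ⟨m, rfl⟩ := Nat.exists_eq_add_of_le' hm
    exact hT.exists_totalD_eq hreg hGexact hx hDx

end TorExtCI
end
end

section
/- Let (S,𝔪) be a local ring, let f_1,…,f_c ∈ 𝔪 be a regular sequence generating the ideal I, let R = S/I, and let K be the Koszul complex of f_1,…,f_c. Let (G_p)_{p≥0} be free S-modules with S-linear maps t_1' : G_p → G_{p−1} satisfying t_1'∘t_1'(G_p) ⊆ I·G_{p−2}, and assume the minimality condition t_1'(G_p) ⊆ 𝔪·G_{p−1} for all p. Let {t_i^{p,q}} be a system of higher CI operators on G. Then for all p: (1) the image of the composite t_2^{p−2,1} ∘ t_2^{p,0} : G_p ⊗ K_0 → G_{p−4} ⊗ K_2 is contained in 𝔪·(G_{p−4} ⊗ K_2), and (2) the image of t_2^{p−3,2} ∘ t_3^{p,0} + t_3^{p−2,1} ∘ t_2^{p,0} : G_p ⊗ K_0 → G_{p−5} ⊗ K_3 is contained in 𝔪·(G_{p−5} ⊗ K_3). In other words, modulo 𝔪 the induced maps t̄_2 square to zero and t̄_2, t̄_3 anticommute, so they yield a complex over the residue field. -/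
open scoped TensorProduct
open DirectSum

noncomputable section

namespace TorExtCI

variable (S : Type*) [CommRing S] (c : ℕ)

variable (G : ℕ → Type*) [∀ p, AddCommGroup (G p)] [∀ p, Module S (G p)]

section

theorem koszulForm_eq_sum (f : Fin c → S) :
    koszulForm S c f = ∑ i, f i • koszulForm S c (Pi.single i 1) := by
  ext j
  simp [koszulForm, Pi.single_apply]

theorem koszulD_eq_sum (f : Fin c → S) (q : ℕ) :
    koszulD S c f q = ∑ i, f i • koszulD S c (Pi.single i 1) q := by
  refine LinearMap.ext fun x => Subtype.ext ?_
  have h : CliffordAlgebra.contractLeft (Q := (0 : QuadraticForm S (Fin c → S)))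
      (koszulForm S c f) = ∑ i, f i • CliffordAlgebra.contractLeft
        (Q := (0 : QuadraticForm S (Fin c → S))) (koszulForm S c (Pi.single i 1)) := by
    rw [koszulForm_eq_sum]
    simp only [map_sum, map_smul]
  simpa [koszulD] using LinearMap.congr_fun h (x : ExteriorAlgebra S (Fin c → S))

variable {S c}

theorem map_mem_smul_top {M N : Type*} [AddCommGroup M] [Module S M] [AddCommGroup N]
    [Module S N] (I : Ideal S) (φ : M →ₗ[S] N) {x : M} (hx : x ∈ I • (⊤ : Submodule S M)) :
    φ x ∈ I • (⊤ : Submodule S N) :=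
  Submodule.smul_top_le_comap_smul_top I φ hx

theorem lTensor_koszulD_mem (I : Ideal S) (f : Fin c → S) (hf : ∀ i, f i ∈ I)
    {M : Type*} [AddCommGroup M] [Module S M] (q : ℕ) (x : M ⊗[S] ↥(KoszulTerm S c q)) :
    LinearMap.lTensor M (koszulD S c f q) x ∈
      I • (⊤ : Submodule S (M ⊗[S] ↥(KoszulTerm S c (q - 1)))) := by
  induction x using TensorProduct.induction_on with
  | zero => simp
  | add x y hx hy => rw [map_add]; exact add_mem hx hy
  | tmul m k =>
    rw [LinearMap.lTensor_tmul]
    refine map_mem_smul_top I (TensorProduct.mk S M _ m) ?_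
    rw [koszulD_eq_sum, LinearMap.sum_apply]
    exact sum_mem fun i _ => Submodule.smul_mem_smul (hf i) Submodule.mem_top

theorem rTensor_mem_smul_top (I : Ideal S) {M N P : Type*} [AddCommGroup M] [Module S M]
    [AddCommGroup N] [Module S N] [AddCommGroup P] [Module S P] (φ : M →ₗ[S] N)
    (hφ : ∀ m, φ m ∈ I • (⊤ : Submodule S N)) (x : M ⊗[S] P) :
    LinearMap.rTensor P φ x ∈ I • (⊤ : Submodule S (N ⊗[S] P)) := by
  induction x using TensorProduct.induction_on with
  | zero => simp
  | add x y hx hy => rw [map_add]; exact add_mem hx hy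
  | tmul m k =>
    rw [LinearMap.rTensor_tmul]
    exact map_mem_smul_top I ((TensorProduct.mk S N P).flip k) (hφ m)

namespace IsHigherCISystem

variable {G} {f : Fin c → S} {t1' : ∀ p, G (p + 1) →ₗ[S] G p}
  {T : ℕ → TotalModule S c G →ₗ[S] TotalModule S c G}

theorem zeroth_mem (hT : IsHigherCISystem S c G f t1' T) (I : Ideal S) (hf : ∀ i, f i ∈ I)
    (z : TotalModule S c G) : T 0 z ∈ I • (⊤ : Submodule S (TotalModule S c G)) := by
  classical
  induction z using DirectSum.induction_on with
  | zero => simp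
  | add x y hx hy => rw [map_add]; exact add_mem hx hy
  | of pq x =>
    obtain ⟨p, q⟩ := pq
    have h := hT.zeroth p q x
    rw [DirectSum.lof_eq_of] at h
    rw [h]
    exact map_mem_smul_top I _ (Submodule.smul_mem _ _ (lTensor_koszulD_mem I f hf q x))

theorem first_mem (hT : IsHigherCISystem S c G f t1' T) (I : Ideal S)
    (hmin : ∀ p x, t1' p x ∈ I • (⊤ : Submodule S (G p)))
    (z : TotalModule S c G) : T 1 z ∈ I • (⊤ : Submodule S (TotalModule S c G)) := by
  classical
  induction z using DirectSum.induction_on with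
  | zero => simp
  | add x y hx hy => rw [map_add]; exact add_mem hx hy
  | of pq x =>
    obtain ⟨p, q⟩ := pq
    cases p with
    | zero =>
      have h := hT.support 1 0 q one_pos x
      rw [DirectSum.lof_eq_of] at h
      rw [h]
      exact zero_mem _
    | succ p =>
      have h := hT.first p q x
      rw [DirectSum.lof_eq_of] at h
      rw [h]
      exact map_mem_smul_top I _ (rTensor_mem_smul_top I (t1' p) (hmin p) x)

theorem incl_proj_apply (hT : IsHigherCISystem S c G f t1' T) (i p q : ℕ)
    (x : G p ⊗[S] ↥(KoszulTerm S c q)) :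
    incl S c G (p - i) (q + i - 1) (proj S c G (p - i) (q + i - 1) (T i (incl S c G p q x))) =
      T i (incl S c G p q x) := by
  rcases lt_or_ge p i with h | h
  · rw [hT.support i p q h x, map_zero, map_zero]
  · obtain ⟨y, hy⟩ := hT.bidegree i p q h x
    rw [← hy, DirectSum.component.lof_self]

end IsHigherCISystem

end

/-- Over a local ring `(S, 𝔪)`, with `f_1, …, f_c ∈ 𝔪` a regular sequence
and `(G, t_1')` minimal (`t_1'(G_p) ⊆ 𝔪·G_{p−1}`), for any system of higher CI operators on
`G` the composite `t_2 ∘ t_2` and the anticommutator `t_2 ∘ t_3 + t_3 ∘ t_2` (evaluated on the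
components `G_p ⊗ K_0`) have image inside `𝔪` times the target; hence modulo `𝔪` the induced
maps `t̄_2` square to zero and `t̄_2`, `t̄_3` anticommute. -/
theorem stmt10 {S : Type*} [CommRing S] [IsLocalRing S] {c : ℕ} (f : Fin c → S)
    (hf𝔪 : ∀ i, f i ∈ IsLocalRing.maximalIdeal S)
    (hreg : IsRegularSeq f)
    (G : ℕ → Type*) [∀ p, AddCommGroup (G p)] [∀ p, Module S (G p)]
    [∀ p, Module.Free S (G p)]
    (t1' : ∀ p, G (p + 1) →ₗ[S] G p)
    (hsq : ∀ p (x : G (p + 2)),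
      t1' p (t1' (p + 1) x) ∈
        Ideal.span (Set.range f) • (⊤ : Submodule S (G p)))
    (hmin : ∀ p (x : G (p + 1)),
      t1' p x ∈ IsLocalRing.maximalIdeal S • (⊤ : Submodule S (G p)))
    (T : ℕ → TotalModule S c G →ₗ[S] TotalModule S c G)
    (hT : IsHigherCISystem S c G f t1' T) :
    -- (1)  t_2^{p−2,1} ∘ t_2^{p,0}  has image in 𝔪·(G_{p−4} ⊗ K_2)
    (∀ p (x : G p ⊗[S] ↥(KoszulTerm S c 0)),
      proj S c G (p - 4) 2
          (T 2 (incl S c G (p - 2) 1 (proj S c G (p - 2) 1 (T 2 (incl S c G p 0 x)))))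
        ∈ IsLocalRing.maximalIdeal S •
            (⊤ : Submodule S (G (p - 4) ⊗[S] ↥(KoszulTerm S c 2)))) ∧
    -- (2)  t_2^{p−3,2} ∘ t_3^{p,0} + t_3^{p−2,1} ∘ t_2^{p,0}  has image in 𝔪·(G_{p−5} ⊗ K_3)
    (∀ p (x : G p ⊗[S] ↥(KoszulTerm S c 0)),
      proj S c G (p - 5) 3
          (T 2 (incl S c G (p - 3) 2 (proj S c G (p - 3) 2 (T 3 (incl S c G p 0 x)))))
      + proj S c G (p - 5) 3
          (T 3 (incl S c G (p - 2) 1 (proj S c G (p - 2) 1 (T 2 (incl S c G p 0 x)))))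
        ∈ IsLocalRing.maximalIdeal S •
            (⊤ : Submodule S (G (p - 5) ⊗[S] ↥(KoszulTerm S c 3)))) := by
  have h0 := hT.zeroth_mem _ hf𝔪
  have h1 := hT.first_mem _ hmin
  have proj_two (p : ℕ) (x : G p ⊗[S] ↥(KoszulTerm S c 0)) :
      incl S c G (p - 2) 1 (proj S c G (p - 2) 1 (T 2 (incl S c G p 0 x))) =
        T 2 (incl S c G p 0 x) := hT.incl_proj_apply 2 p 0 x
  have proj_three (p : ℕ) (x : G p ⊗[S] ↥(KoszulTerm S c 0)) :
      incl S c G (p - 3) 2 (proj S c G (p - 3) 2 (T 3 (incl S c G p 0 x))) =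
        T 3 (incl S c G p 0 x) := hT.incl_proj_apply 3 p 0 x
  refine ⟨fun p x => ?_, fun p x => ?_⟩
  · rw [proj_two]
    refine map_mem_smul_top _ _ ?_
    set z := incl S c G p 0 x
    have h := LinearMap.congr_fun (hT.quadratic 4) z
    simp only [Finset.sum_range_succ, Finset.sum_range_zero, zero_add, LinearMap.add_apply,
      LinearMap.comp_apply, LinearMap.zero_apply, Nat.reduceSub, Nat.reduceAdd] at h
    have e : T 2 (T 2 z) = -(T 0 (T 4 z) + T 1 (T 3 z) + T 3 (T 1 z) + T 4 (T 0 z)) := by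
      rw [eq_neg_iff_add_eq_zero, ← h]; abel
    rw [e]
    exact neg_mem (add_mem (add_mem (add_mem (h0 _) (h1 _)) (map_mem_smul_top _ _ (h1 _)))
      (map_mem_smul_top _ _ (h0 _)))
  · rw [proj_two, proj_three, ← map_add]
    refine map_mem_smul_top _ _ ?_
    set z := incl S c G p 0 x
    have h := LinearMap.congr_fun (hT.quadratic 5) z
    simp only [Finset.sum_range_succ, Finset.sum_range_zero, zero_add, LinearMap.add_apply,
      LinearMap.comp_apply, LinearMap.zero_apply, Nat.reduceSub, Nat.reduceAdd] at h
    have e : T 2 (T 3 z) + T 3 (T 2 z) =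
        -(T 0 (T 5 z) + T 1 (T 4 z) + T 4 (T 1 z) + T 5 (T 0 z)) := by
      rw [eq_neg_iff_add_eq_zero, ← h]; abel
    rw [e]
    exact neg_mem (add_mem (add_mem (add_mem (h0 _) (h1 _)) (map_mem_smul_top _ _ (h1 _)))
      (map_mem_smul_top _ _ (h0 _)))

end TorExtCI
end
end
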